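/- Suppose in addition that θ : U → ℝ is a smooth function satisfying X1(θ) = c12^1 and X2(θ) = −c12^2 on U, and set Y1 := cosh(θ)·X1 + sinh(θ)·X2, Y2 := sinh(θ)·X1 + cosh(θ)·X2, and κ := X2(c12^1) + X1(c12^2) − (c12^1)² + (c12^2)² − c. Then, pointwise on U, ⁅Y1,X0⁆ = −κ·Y2, ⁅Y2,X0⁆ = −κ·Y1, and ⁅Y2,Y1⁆ = X0. -/

import Mathlib

/-- Lie bracket of vector fields on (an open subset of) ℝ³:
⁅V,W⁆(p) = DW(p)(V(p)) − DV(p)(W(p)). -/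
noncomputable def vlie (V W : (Fin 3 → ℝ) → (Fin 3 → ℝ)) : (Fin 3 → ℝ) → (Fin 3 → ℝ) :=
  fun p => fderiv ℝ W p (V p) - fderiv ℝ V p (W p)

/-- Directional derivative X(f) : p ↦ Df(p)(X(p)). -/
noncomputable def vder (X : (Fin 3 → ℝ) → (Fin 3 → ℝ)) (f : (Fin 3 → ℝ) → ℝ) :
    (Fin 3 → ℝ) → ℝ :=
  fun p => fderiv ℝ f p (X p)

open VectorField in
/-- The bracket acts on functions as the commutator of directional derivatives. -/
theorem fderiv_apply_vlie {V W : (Fin 3 → ℝ) → (Fin 3 → ℝ)} {f : (Fin 3 → ℝ) → ℝ}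
    {p : Fin 3 → ℝ} (hf : ContDiffAt ℝ 2 f p)
    (hV : DifferentiableAt ℝ V p) (hW : DifferentiableAt ℝ W p) :
    fderiv ℝ f p (vlie V W p) = vder V (vder W f) p - vder W (vder V f) p :=
  fderiv_apply_lieBracket hf (by simp) hW hV

/-- The derivative of a combination `a • V + b • W` of vector fields, applied to a vector. -/
theorem fderiv_smul_add_smul_apply {V W : (Fin 3 → ℝ) → (Fin 3 → ℝ)} {a b : (Fin 3 → ℝ) → ℝ}
    {a' b' : (Fin 3 → ℝ) →L[ℝ] ℝ} {p : Fin 3 → ℝ}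
    (ha : HasFDerivAt a a' p) (hb : HasFDerivAt b b' p)
    (hV : DifferentiableAt ℝ V p) (hW : DifferentiableAt ℝ W p) (v : Fin 3 → ℝ) :
    fderiv ℝ (fun q => a q • V q + b q • W q) p v =
      a p • fderiv ℝ V p v + a' v • V p + (b p • fderiv ℝ W p v + b' v • W p) := by
  have h := (ha.fun_smul hV.hasFDerivAt).fun_add (hb.fun_smul hW.hasFDerivAt)
  rw [h.fderiv]
  simp

/-- If θ satisfies X1(θ) = c12^1 and X2(θ) = −c12^2 on U, then the hyperbolically rotated
frame Y1, Y2 satisfies ⁅Y1,X0⁆ = −κ·Y2, ⁅Y2,X0⁆ = −κ·Y1, ⁅Y2,Y1⁆ = X0, where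
κ = X2(c12^1) + X1(c12^2) − (c12^1)² + (c12^2)² − c. -/
theorem normalized_frame_brackets_htilde_zero
    (U : Set (Fin 3 → ℝ)) (hU : IsOpen U)
    (X0 X1 X2 : (Fin 3 → ℝ) → (Fin 3 → ℝ))
    (hX0 : ContDiffOn ℝ (⊤ : ℕ∞) X0 U) (hX1 : ContDiffOn ℝ (⊤ : ℕ∞) X1 U) (hX2 : ContDiffOn ℝ (⊤ : ℕ∞) X2 U)
    (c c121 c122 : (Fin 3 → ℝ) → ℝ)
    (hc : ContDiffOn ℝ (⊤ : ℕ∞) c U)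
    (hc121 : ContDiffOn ℝ (⊤ : ℕ∞) c121 U) (hc122 : ContDiffOn ℝ (⊤ : ℕ∞) c122 U)
    (hb1 : ∀ p ∈ U, vlie X1 X0 p = c p • X2 p)
    (hb2 : ∀ p ∈ U, vlie X2 X0 p = c p • X1 p)
    (hb3 : ∀ p ∈ U, vlie X2 X1 p = c121 p • X1 p + c122 p • X2 p + X0 p)
    (θ : (Fin 3 → ℝ) → ℝ) (hθ : ContDiffOn ℝ (⊤ : ℕ∞) θ U)
    (hθ1 : ∀ p ∈ U, vder X1 θ p = c121 p)
    (hθ2 : ∀ p ∈ U, vder X2 θ p = -c122 p)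
    (Y1 Y2 : (Fin 3 → ℝ) → (Fin 3 → ℝ))
    (hY1 : Y1 = fun p => Real.cosh (θ p) • X1 p + Real.sinh (θ p) • X2 p)
    (hY2 : Y2 = fun p => Real.sinh (θ p) • X1 p + Real.cosh (θ p) • X2 p)
    (κ : (Fin 3 → ℝ) → ℝ)
    (hκ : κ = fun p =>
      vder X2 c121 p + vder X1 c122 p - (c121 p) ^ 2 + (c122 p) ^ 2 - c p) :
    ∀ p ∈ U,
      vlie Y1 X0 p = -κ p • Y2 p ∧
      vlie Y2 X0 p = -κ p • Y1 p ∧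
      vlie Y2 Y1 p = X0 p := by
  intro p hp
  have hUp : U ∈ nhds p := hU.mem_nhds hp
  have dX1 : DifferentiableAt ℝ X1 p := (hX1.contDiffAt hUp).differentiableAt (by simp)
  have dX2 : DifferentiableAt ℝ X2 p := (hX2.contDiffAt hUp).differentiableAt (by simp)
  have sθ : ContDiffAt ℝ 2 θ p := (hθ.contDiffAt hUp).of_le (WithTop.coe_le_coe.2 (le_top : (2 : ℕ∞) ≤ ⊤))
  have dθ : HasFDerivAt θ (fderiv ℝ θ p) p := (sθ.differentiableAt (by simp)).hasFDerivAt
  have e1 : vder X1 θ =ᶠ[nhds p] c121 := Filter.mem_of_superset hUp hθ1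
  have e2 : vder X2 θ =ᶠ[nhds p] fun q => -c122 q := Filter.mem_of_superset hUp hθ2
  have t1 : fderiv ℝ θ p (X1 p) = c121 p := hθ1 p hp
  have t2 : fderiv ℝ θ p (X2 p) = -c122 p := hθ2 p hp
  have t0 : fderiv ℝ θ p (X0 p) = c p + κ p := by
    have h := fderiv_apply_vlie sθ dX2 dX1
    have h1 : vder X2 (vder X1 θ) p = vder X2 c121 p := by
      simp only [vder] at e1 ⊢
      rw [e1.fderiv_eq]
    have h2 : vder X1 (vder X2 θ) p = -vder X1 c122 p := by
      simp only [vder] at e2 ⊢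
      rw [e2.fderiv_eq, fderiv_fun_neg, neg_apply]
    rw [hb3 p hp, h1, h2] at h
    simp only [map_add, map_smul, smul_eq_mul, t1, t2] at h
    rw [hκ]
    linear_combination h
  have dY1 := fderiv_smul_add_smul_apply dθ.cosh dθ.sinh dX1 dX2
  have dY2 := fderiv_smul_add_smul_apply dθ.sinh dθ.cosh dX1 dX2
  have b1 := hb1 p hp
  have b2 := hb2 p hp
  have b3 := hb3 p hp
  have hcs := Real.cosh_sq (θ p)
  subst hY1 hY2
  simp only [vlie] at b1 b2 b3 ⊢
  simp only [dY1, dY2, map_add, map_smul, smul_apply, smul_eq_mul, t0, t1, t2]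
  refine ⟨?_, ?_, ?_⟩
  · linear_combination (norm := module) Real.cosh (θ p) • b1 + Real.sinh (θ p) • b2
  · linear_combination (norm := module) Real.sinh (θ p) • b1 + Real.cosh (θ p) • b2
  · ext i
    have b3i := congrFun b3 i
    simp only [Pi.add_apply, Pi.sub_apply, Pi.smul_apply, smul_eq_mul] at b3i ⊢
    linear_combination b3i + (fderiv ℝ X1 p (X2 p) i - fderiv ℝ X2 p (X1 p) i
      - c121 p * X1 p i - c122 p * X2 p i) * hcs
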